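/- For every integer q ≥ 2, the graph K_{2,q}^+ is determined by its spectrum: every finite simple graph cospectral with K_{2,q}^+ is isomorphic to K_{2,q}^+. -/

import Mathlib

open SimpleGraph Polynomial Matrix

universe u

/-- The graph `K_{p,q}⁻`, obtained from the complete bipartite graph `K_{p,q}`
by deleting one edge (the edge between the first vertex of each part). -/
def KpqMinus (p q : ℕ) : SimpleGraph (Fin p ⊕ Fin q) :=
  SimpleGraph.fromRel fun u v =>
    ∃ (i : Fin p) (j : Fin q), u = Sum.inl i ∧ v = Sum.inr j ∧ ¬(i.val = 0 ∧ j.val = 0)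

/-- The graph `K_{p,q}⁺`, obtained from the complete bipartite graph `K_{p,q}`
by adding a new vertex `x` together with a new edge `xy`, where `y` is a vertex
in the partite set of order `p`. -/
def KpqPlus (p q : ℕ) : SimpleGraph ((Fin p ⊕ Fin q) ⊕ Unit) :=
  SimpleGraph.fromRel fun u v =>
    (∃ (i : Fin p) (j : Fin q), u = Sum.inl (Sum.inl i) ∧ v = Sum.inl (Sum.inr j)) ∨
    (∃ i : Fin p, i.val = 0 ∧ u = Sum.inl (Sum.inl i) ∧ v = Sum.inr ())

/-- The disjoint union of a graph `G` with `m` isolated vertices. -/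
def addIsolated {V : Type*} (G : SimpleGraph V) (m : ℕ) : SimpleGraph (V ⊕ Fin m) :=
  SimpleGraph.fromRel fun u v => ∃ a b, u = Sum.inl a ∧ v = Sum.inl b ∧ G.Adj a b

open scoped Classical in
/-- The real adjacency matrix of a finite simple graph. -/
noncomputable def adjMat {V : Type*} [Fintype V] [DecidableEq V] (G : SimpleGraph V) :
    Matrix V V ℝ :=
  Matrix.of fun i j => if G.Adj i j then (1 : ℝ) else 0

/-- Two finite simple graphs are cospectral if their adjacency matrices have the same
characteristic polynomial. -/
def Cospectral {V W : Type*} [Fintype V] [DecidableEq V] [Fintype W] [DecidableEq W]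
    (G : SimpleGraph V) (H : SimpleGraph W) : Prop :=
  (adjMat G).charpoly = (adjMat H).charpoly

/-- A finite simple graph is determined by its spectrum (DS) if every graph cospectral
with it is isomorphic to it. -/
def IsDS {V : Type*} [Fintype V] [DecidableEq V] (G : SimpleGraph V) : Prop :=
  ∀ (W : Type u) [Fintype W] [DecidableEq W] (H : SimpleGraph W),
    Cospectral G H → Nonempty (G ≃g H)

/-- The spectral radius of a finite simple graph: the largest eigenvalue of its
adjacency matrix. -/
noncomputable def specRadius {V : Type*} [Fintype V] [DecidableEq V]
    (G : SimpleGraph V) : ℝ :=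
  sSup {x : ℝ | ∃ v : V → ℝ, v ≠ 0 ∧ (adjMat G).mulVec v = x • v}

/-- A graph is bipartite if its vertex set can be partitioned into two parts such that
every edge joins a vertex of one part to a vertex of the other. -/
def IsBipartite {V : Type*} (G : SimpleGraph V) : Prop :=
  ∃ s : Set V, ∀ a b, G.Adj a b → (a ∈ s ∧ b ∉ s) ∨ (a ∉ s ∧ b ∈ s)

section Matrices

variable {m n k l : Type*} [Fintype m] [Fintype n] [Fintype k] [Fintype l]
  [DecidableEq m] [DecidableEq n] [DecidableEq k] [DecidableEq l]

theorem Matrix.IsHermitian.exists_conj_of_charpoly_eq {A B : Matrix n n ℝ}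
    (hA : A.IsHermitian) (hB : B.IsHermitian) (h : A.charpoly = B.charpoly) :
    ∃ P Q : Matrix n n ℝ, Q * P = 1 ∧ A = P * B * Q := by
  have he := (hA.eigenvalues_eq_eigenvalues_iff hB).2 h
  have h1 := hA.spectral_theorem
  have h2 := hB.spectral_theorem
  rw [Unitary.conjStarAlgAut_apply] at h1 h2
  rw [← he] at h2
  set U := hA.eigenvectorUnitary
  set V := hB.eigenvectorUnitary
  set D : Matrix n n ℝ := diagonal (RCLike.ofReal ∘ hA.eigenvalues)
  have hU : (star U : Matrix n n ℝ) * (U : Matrix n n ℝ) = 1 := Unitary.coe_star_mul_self U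
  have hV : (star V : Matrix n n ℝ) * (V : Matrix n n ℝ) = 1 := Unitary.coe_star_mul_self V
  refine ⟨(U : Matrix n n ℝ) * (star V : Matrix n n ℝ),
    (V : Matrix n n ℝ) * (star U : Matrix n n ℝ), ?_, ?_⟩
  · rw [Matrix.mul_assoc, ← Matrix.mul_assoc (star U : Matrix n n ℝ), hU, Matrix.one_mul]
    exact Unitary.coe_mul_star_self V
  · calc A = (U : Matrix n n ℝ) * ((star V : Matrix n n ℝ) * V) * D *
          ((star V : Matrix n n ℝ) * V) * (star U : Matrix n n ℝ) := by
            rw [hV, Matrix.mul_one, Matrix.mul_one]; exact h1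
      _ = (U : Matrix n n ℝ) * (star V : Matrix n n ℝ) * (V * D * (star V : Matrix n n ℝ)) *
          (V * (star U : Matrix n n ℝ)) := by simp only [Matrix.mul_assoc]
      _ = _ := by rw [← h2]

theorem Matrix.card_eq_of_charpoly_eq {A : Matrix m m ℝ} {B : Matrix n n ℝ}
    (h : A.charpoly = B.charpoly) : Fintype.card m = Fintype.card n := by
  rw [← A.charpoly_natDegree_eq_dim, h, B.charpoly_natDegree_eq_dim]

omit [DecidableEq k] in
/-- A factorization of a symmetric matrix transfers to every symmetric matrix with the same
characteristic polynomial. -/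
theorem Matrix.exists_factorization_of_charpoly_eq {A : Matrix m m ℝ}
    {L : Matrix n k ℝ} {R : Matrix k n ℝ} (hA : A.IsHermitian) (hB : (L * R).IsHermitian)
    (h : A.charpoly = (L * R).charpoly) :
    ∃ (L' : Matrix m k ℝ) (R' : Matrix k m ℝ), A = L' * R' ∧ R' * L' = R * L := by
  let e : m ≃ n := Fintype.equivOfCardEq (Matrix.card_eq_of_charpoly_eq h)
  have hA' : (reindex e e A).IsHermitian := by
    simpa using hA.submatrix e.symm
  obtain ⟨P, Q, hQP, hPQ⟩ := hA'.exists_conj_of_charpoly_eq hB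
    ((Matrix.charpoly_reindex e A).trans h)
  refine ⟨(P * L).submatrix e id, (R * Q).submatrix id e, ?_, ?_⟩
  · have : A = (reindex e e A).submatrix e e := by ext; simp
    rw [this, hPQ, ← Matrix.submatrix_mul _ _ e id e Function.bijective_id]
    simp only [Matrix.mul_assoc]
  · rw [Matrix.submatrix_mul_equiv, Matrix.submatrix_id_id, Matrix.mul_assoc,
      ← Matrix.mul_assoc Q, hQP, Matrix.one_mul]

omit [Fintype n] [DecidableEq n] in
/-- A matrix factoring through `k` is recovered from its rows and columns along any invertible
`k × k` submatrix. -/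
theorem Matrix.eq_mul_mul_of_submatrix_mul_eq_one {L : Matrix n k ℝ} {R : Matrix k n ℝ}
    (S : k → n) {M : Matrix k k ℝ} (h : (L * R).submatrix S S * M = 1) :
    L * R = (L * R).submatrix id S * (M * (L * R).submatrix S id) := by
  have e1 : (L * R).submatrix S S = L.submatrix S id * R.submatrix id S := by
    ext; simp [Matrix.mul_apply]
  have e2 : (L * R).submatrix id S = L * R.submatrix id S := by
    ext; simp [Matrix.mul_apply]
  have e3 : (L * R).submatrix S id = L.submatrix S id * R := by
    ext; simp [Matrix.mul_apply]
  have h' : R.submatrix id S * M * L.submatrix S id = 1 := by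
    rw [_root_.mul_eq_one_comm, ← Matrix.mul_assoc, ← e1, h]
  rw [e2, e3]
  calc L * R = L * (R.submatrix id S * M * L.submatrix S id) * R := by rw [h', Matrix.mul_one]
    _ = _ := by simp only [Matrix.mul_assoc]

theorem Matrix.X_pow_mul_charpoly_eq {L : Matrix n k ℝ} {R : Matrix k n ℝ}
    {L' : Matrix n l ℝ} {R' : Matrix l n ℝ} (h : L * R = L' * R') :
    (X : ℝ[X]) ^ Fintype.card l * (R * L).charpoly =
      X ^ Fintype.card k * (R' * L').charpoly := by
  have h1 := Matrix.charpoly_mul_comm' L R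
  have h2 := Matrix.charpoly_mul_comm' L' R'
  rw [h] at h1
  apply mul_left_cancel₀ (pow_ne_zero (Fintype.card n) (X_ne_zero (R := ℝ)))
  calc _ = X ^ Fintype.card l * (X ^ Fintype.card n * (R * L).charpoly) := by ring
    _ = X ^ Fintype.card k * (X ^ Fintype.card l * (L' * R').charpoly) := by rw [← h1]; ring
    _ = _ := by rw [h2]; ring

theorem Matrix.charpoly_eq_of_mul_eq_mul {L L' : Matrix n k ℝ} {R R' : Matrix k n ℝ}
    (h : L * R = L' * R') : (R * L).charpoly = (R' * L').charpoly :=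
  mul_left_cancel₀ (pow_ne_zero _ X_ne_zero) (Matrix.X_pow_mul_charpoly_eq h)

end Matrices

section AdjMat

variable {V : Type*} [Fintype V] [DecidableEq V] {G : SimpleGraph V}

open scoped Classical in
theorem adjMat_apply (G : SimpleGraph V) (u v : V) :
    adjMat G u v = if G.Adj u v then 1 else 0 := rfl

theorem adjMat_isHermitian (G : SimpleGraph V) : (adjMat G).IsHermitian := by
  ext u v
  by_cases h : G.Adj u v
  · simp [adjMat_apply, h, h.symm]
  · simpa [adjMat_apply, h] using fun hvu : G.Adj v u => h hvu.symm

theorem adjMat_nonneg (u v : V) : 0 ≤ adjMat G u v := by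
  rw [adjMat_apply]; split_ifs <;> simp

open scoped Classical in
/-- The number of common neighbours of two vertices. -/
noncomputable def codeg (G : SimpleGraph V) (u v : V) : ℕ :=
  (Finset.univ.filter fun t => G.Adj u t ∧ G.Adj v t).card

omit [DecidableEq V] in
theorem codeg_comm (u v : V) : codeg G u v = codeg G v u := by
  simp only [codeg]
  congr 1 with t
  simp [and_comm]

omit [DecidableEq V] in
theorem codeg_pos {u v t : V} (hu : G.Adj u t) (hv : G.Adj v t) : 1 ≤ codeg G u v :=
  Finset.card_pos.2 ⟨t, by simp [hu, hv]⟩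

omit [DecidableEq V] in
theorem codeg_eq_zero {u v : V} (h : ∀ t, G.Adj u t → ¬ G.Adj v t) : codeg G u v = 0 := by
  simpa [codeg, Finset.filter_eq_empty_iff] using h

omit [DecidableEq V] in
theorem codeg_le (u v : V) : codeg G u v ≤ codeg G u u :=
  Finset.card_le_card fun t => by simp +contextual

omit [DecidableEq V] in
theorem codeg_lt {u v t : V} (hu : G.Adj u t) (hv : ¬ G.Adj v t) :
    codeg G u v < codeg G u u := by
  refine Finset.card_lt_card (Finset.ssubset_iff_of_subset (fun t => ?_) |>.2 ⟨t, ?_⟩)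
  · simp +contextual
  · simp [hu, hv]

omit [DecidableEq V] in
theorem exists_of_codeg_lt {u v : V} (h : codeg G u v < codeg G u u) :
    ∃ t, G.Adj u t ∧ ¬ G.Adj v t := by
  by_contra! hc
  refine h.not_ge (Finset.card_le_card fun t => ?_)
  simp only [Finset.mem_filter, Finset.mem_univ, true_and, and_self]
  exact fun ht => ⟨ht, hc t ht⟩

theorem adjMat_submatrix_mul_submatrix {k : Type*} (S : k → V) (i j : k) :
    ((adjMat G).submatrix S id * (adjMat G).submatrix id S) i j = codeg G (S i) (S j) := by
  classical
  simp [Matrix.mul_apply, adjMat_apply, codeg, G.adj_comm _ (S j), ← ite_and,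
    Finset.sum_boole, and_comm]

theorem triangleFree_of_trace_eq_zero (h : (adjMat G * adjMat G * adjMat G).trace = 0)
    {u v t : V} (huv : G.Adj u v) (hvt : G.Adj v t) : ¬ G.Adj t u := by
  intro htu
  simp only [Matrix.trace, Matrix.diag, Matrix.mul_apply, Finset.sum_mul] at h
  have nn : ∀ a b c : V, 0 ≤ adjMat G a c * adjMat G c b * adjMat G b a := fun a b c =>
    mul_nonneg (mul_nonneg (adjMat_nonneg _ _) (adjMat_nonneg _ _)) (adjMat_nonneg _ _)
  rw [Finset.sum_eq_zero_iff_of_nonneg fun a _ => Finset.sum_nonneg fun b _ =>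
    Finset.sum_nonneg fun c _ => nn a b c] at h
  have h1 := h u (Finset.mem_univ _)
  rw [Finset.sum_eq_zero_iff_of_nonneg fun b _ => Finset.sum_nonneg fun c _ => nn u b c] at h1
  have h2 := h1 t (Finset.mem_univ _)
  rw [Finset.sum_eq_zero_iff_of_nonneg fun c _ => nn u t c] at h2
  have h3 := h2 v (Finset.mem_univ _)
  simp [adjMat_apply, huv, hvt, htu] at h3

omit [Fintype V] [DecidableEq V] in
/-- A triangle-free graph with neither an induced path on four vertices nor an induced matching of
two edges is complete bipartite up to isolated vertices. -/
theorem adj_iff_of_forall_not_path (ht : ∀ u v t, G.Adj u v → G.Adj v t → ¬ G.Adj t u)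
    (hP : ∀ w x y z, G.Adj w x → G.Adj x y → G.Adj y z → ¬ G.Adj w z →
      G.Adj w y ∨ G.Adj x z)
    (hK : ∀ w x y z, G.Adj w x → G.Adj y z →
      G.Adj w y ∨ G.Adj w z ∨ G.Adj x y ∨ G.Adj x z) {w x : V} (hwx : G.Adj w x) (u v : V) :
    G.Adj u v ↔ (G.Adj u w ∧ G.Adj x v) ∨ (G.Adj u x ∧ G.Adj w v) := by
  have sy : ∀ a b, G.Adj a b → G.Adj b a := fun a b h => h.symm
  constructor
  · intro huv
    have := hK u v w x huv hwx
    grind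
  · grind

end AdjMat

theorem eval_charpoly_bipartite (t a b c d e f g h : ℝ) :
    (!![0, a, 0, b; c, 0, d, 0; 0, e, 0, f; g, 0, h, 0] :
      Matrix (Fin 4) (Fin 4) ℝ).charpoly.eval t =
      t ^ 4 - (a * c + b * g + e * d + f * h) * t ^ 2 +
        (a * f - b * e) * (c * h - d * g) := by
  have : scalar (Fin 4) t - !![0, a, 0, b; c, 0, d, 0; 0, e, 0, f; g, 0, h, 0] =
      !![t, -a, 0, -b; -c, t, -d, 0; 0, -e, t, -f; -g, 0, -h, t] := by
    ext i j
    fin_cases i <;> fin_cases j <;> simp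
  rw [Matrix.eval_charpoly, this]
  simp [Matrix.det_succ_row_zero, Fin.sum_univ_succ, Fin.succAbove]
  ring

/-- The matrix `R * L` for a factorization `L * R` of the adjacency matrix of `K_{2,q}⁺`. -/
def kernelMatrix (q : ℕ) : Matrix (Fin 4) (Fin 4) ℝ :=
  !![0, q, 0, 1; 1, 0, 1, 0; 0, q, 0, 0; 1, 0, 0, 0]

theorem exists_factorization_adjMat_KpqPlus (q : ℕ) :
    ∃ (L : Matrix ((Fin 2 ⊕ Fin q) ⊕ Unit) (Fin 4) ℝ)
      (R : Matrix (Fin 4) ((Fin 2 ⊕ Fin q) ⊕ Unit) ℝ),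
      adjMat (KpqPlus 2 q) = L * R ∧ R * L = kernelMatrix q := by
  refine ⟨of (Sum.elim (Sum.elim ![![1, 0, 0, 0], ![0, 0, 1, 0]] fun _ => ![0, 1, 0, 0])
      fun _ => ![0, 0, 0, 1]),
    (of (Sum.elim (Sum.elim ![![0, 1, 0, 1], ![0, 1, 0, 0]] fun _ => ![1, 0, 1, 0])
      fun _ => ![1, 0, 0, 0]))ᵀ, ?_, ?_⟩
  · ext u v
    rcases u with (i | i) | i <;> rcases v with (j | j) | j <;>
      simp only [adjMat_apply, KpqPlus, Matrix.mul_apply, Fin.sum_univ_four, fromRel_adj] <;>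
      (try fin_cases i) <;> (try fin_cases j) <;> simp
  · ext i j
    fin_cases i <;> fin_cases j <;> simp [Matrix.mul_apply, kernelMatrix]

theorem eval_charpoly_kernelMatrix (q : ℕ) (t : ℝ) :
    (kernelMatrix q).charpoly.eval t = t ^ 4 - (2 * q + 1) * t ^ 2 + q := by
  rw [kernelMatrix, eval_charpoly_bipartite]
  ring

theorem trace_kernelMatrix_cube (q : ℕ) :
    (kernelMatrix q * kernelMatrix q * kernelMatrix q).trace = 0 := by
  simp [kernelMatrix, Matrix.trace, Fin.sum_univ_four]

theorem sizes_of_path_blowup {a b c d e f q : ℕ} (ha : 1 ≤ a) (hb : 1 ≤ b) (hc : 1 ≤ c)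
    (hd : 1 ≤ d) (hef : e = 0 ∨ f = 0)
    (h0 : (b * d + b * e + d * e) * (a * c + a * f + c * f) = q)
    (h1 : a * b + b * c + c * d + e * a + f * d = 2 * q + 1) : b = q ∨ c = q := by
  have key : ∀ m n : ℕ, 1 ≤ n → m ≤ m * n := fun m n hn => Nat.le_mul_of_pos_right m hn
  by_cases hn : e = 0 ∧ f = 0
  · obtain ⟨rfl, rfl⟩ := hn
    have k1 := key (b * c) (a * d) (Nat.mul_pos ha hd)
    have k2 : a * b + c * d ≤ a * b * (c * d) + 1 := by
      nlinarith [Nat.mul_pos ha hb, Nat.mul_pos hc hd]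
    have k3 : b * c = q := by nlinarith
    have k4 : a * d = 1 := by
      have : b * c * (a * d) = b * c * 1 := by linarith
      exact Nat.eq_of_mul_eq_mul_left (Nat.mul_pos hb hc) this
    obtain ⟨rfl, rfl⟩ := _root_.mul_eq_one.1 k4
    have k5 : b = 1 ∨ c = 1 := by
      by_contra! hbc
      have : 2 ≤ b := by omega
      have : 2 ≤ c := by omega
      nlinarith
    rcases k5 with rfl | rfl
    · right; linarith
    · left; linarith
  · exfalso
    have k1 := key (a * b) (c * d) (Nat.mul_pos hc hd)
    have k2 := key (b * c) (a * d) (Nat.mul_pos ha hd)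
    have k3 := key (c * d) (a * b) (Nat.mul_pos ha hb)
    rcases hef with rfl | rfl
    · have hf : 1 ≤ f := by omega
      have k4 := key (f * d) (b * a) (Nat.mul_pos hb ha)
      have k5 := key (a * b) (f * d) (Nat.mul_pos hf hd)
      have := Nat.zero_le (b * d * (c * f))
      nlinarith
    · have he : 1 ≤ e := by omega
      have k4 := key (e * a) (d * c) (Nat.mul_pos hd hc)
      have k5 := key (c * d) (a * e) (Nat.mul_pos ha he)
      have := Nat.zero_le (b * e * (a * c))
      nlinarith

theorem not_two_complete_bipartite_sizes {a b c d q : ℕ} (ha : 1 ≤ a) (hb : 1 ≤ b) (hc : 1 ≤ c)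
    (hd : 1 ≤ d) (h0 : a * b * (c * d) = q) (h1 : a * b + c * d = 2 * q + 1) : False := by
  nlinarith [Nat.mul_pos ha hb, Nat.mul_pos hc hd]

section Classification

variable {V : Type*} [Fintype V] [DecidableEq V] {G : SimpleGraph V} {q : ℕ}
  {L : Matrix V (Fin 4) ℝ} {R : Matrix (Fin 4) V ℝ}

theorem charpoly_kernelMatrix_eq (hA : adjMat G = L * R) (hK : R * L = kernelMatrix q)
    (S : Fin 4 → V) {M : Matrix (Fin 4) (Fin 4) ℝ}
    (hM : (adjMat G).submatrix S S * M = 1) :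
    (kernelMatrix q).charpoly = (M * of fun i j => (codeg G (S i) (S j) : ℝ)).charpoly := by
  have h := Matrix.eq_mul_mul_of_submatrix_mul_eq_one (L := L) (R := R) S (M := M)
    (by rw [← hA, hM])
  rw [← hK, Matrix.charpoly_eq_of_mul_eq_mul h, Matrix.mul_assoc, ← hA]
  congr 2
  ext i j
  exact adjMat_submatrix_mul_submatrix S i j

theorem codeg_eq_of_induced_path (hA : adjMat G = L * R) (hK : R * L = kernelMatrix q)
    (ht : ∀ u v t, G.Adj u v → G.Adj v t → ¬ G.Adj t u) {w x y z : V}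
    (hwx : G.Adj w x) (hxy : G.Adj x y) (hyz : G.Adj y z) (hwy : ¬ G.Adj w y)
    (hxz : ¬ G.Adj x z) (hwz : ¬ G.Adj w z) : codeg G w y = q ∨ codeg G x z = q := by
  let M : Matrix (Fin 4) (Fin 4) ℝ := !![0, 1, 0, -1; 1, 0, 0, 0; 0, 0, 0, 1; -1, 0, 1, 0]
  have hM : (adjMat G).submatrix ![w, x, y, z] ![w, x, y, z] * M = 1 := by
    have : (adjMat G).submatrix ![w, x, y, z] ![w, x, y, z] =
        !![0, 1, 0, 0; 1, 0, 1, 0; 0, 1, 0, 1; 0, 0, 1, 0] := by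
      ext i j
      fin_cases i <;> fin_cases j <;>
        simp [adjMat_apply, hwx, hxy, hyz, hwy, hxz, hwz, hwx.symm, hxy.symm, hyz.symm,
          G.adj_comm y w, G.adj_comm z x, G.adj_comm z w]
    rw [this]
    ext i j
    fin_cases i <;> fin_cases j <;> simp [M, Matrix.mul_apply, Fin.sum_univ_four]
  have hform : ∀ u v, adjMat G u v =
      adjMat G u w * (adjMat G x v - adjMat G z v) + adjMat G u x * adjMat G w v +
        adjMat G u y * adjMat G z v + adjMat G u z * (adjMat G y v - adjMat G w v) := by
    intro u v
    have h := Matrix.eq_mul_mul_of_submatrix_mul_eq_one (L := L) (R := R) ![w, x, y, z] (M := M)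
      (by rw [← hA, hM])
    rw [← hA] at h
    have := congrFun (congrFun h u) v
    rw [this]
    simp only [Matrix.mul_apply, Fin.sum_univ_four]
    simp [M]
    ring
  have hwz' : ∀ u, G.Adj w u → ¬ G.Adj z u := by
    intro u hw hz
    have := hform u u
    have h1 : ¬ G.Adj x u := fun h => ht _ _ _ hw h.symm hwx.symm
    have h2 : ¬ G.Adj y u := fun h => ht _ _ _ hz h.symm hyz
    simp [adjMat_apply, hw, hz, hw.symm, hz.symm, h1, h2, G.adj_comm u x, G.adj_comm u y] at this
    norm_num at this
  have hef : codeg G w w = codeg G w y ∨ codeg G z z = codeg G z x := by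
    by_contra! hc
    obtain ⟨u, hwu, hyu⟩ := exists_of_codeg_lt (lt_of_le_of_ne (codeg_le w y) hc.1.symm)
    obtain ⟨v, hzv, hxv⟩ := exists_of_codeg_lt (lt_of_le_of_ne (codeg_le z x) hc.2.symm)
    have h1 : ¬ G.Adj x u := fun h => ht _ _ _ hwu h.symm hwx.symm
    have h2 : ¬ G.Adj w v := fun h => hwz' v h hzv
    have := hform u v
    have h3 := adjMat_nonneg (G := G) u v
    simp [adjMat_apply, hwu.symm, hzv, hxv, h1, h2, hyu, hwz' u hwu, G.adj_comm u x,
      G.adj_comm u y, G.adj_comm u z] at this h3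
    split_ifs at this <;> linarith
  have hch := charpoly_kernelMatrix_eq hA hK ![w, x, y, z] hM
  obtain ⟨e, he⟩ := Nat.exists_eq_add_of_le (codeg_le (G := G) w y)
  obtain ⟨f, hf⟩ := Nat.exists_eq_add_of_le (codeg_le (G := G) z x)
  obtain ⟨a, ha⟩ := Nat.exists_eq_add_of_le (codeg_le (G := G) x z)
  obtain ⟨d, hd⟩ := Nat.exists_eq_add_of_le (codeg_le (G := G) y w)
  have ha1 : 1 ≤ a := by
    have := codeg_lt hwx.symm fun h => hwz h.symm
    omega
  have hd1 : 1 ≤ d := by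
    have := codeg_lt hyz hwz
    omega
  have hb1 : 1 ≤ codeg G w y := codeg_pos hwx hxy.symm
  have hc1 : 1 ≤ codeg G x z := codeg_pos hxy hyz.symm
  have hG : (of fun i j => (codeg G (![w, x, y, z] i) (![w, x, y, z] j) : ℝ)) =
      !![(codeg G w y + e : ℝ), 0, codeg G w y, 0; 0, codeg G x z + a, 0, codeg G x z;
        (codeg G w y : ℝ), 0, codeg G w y + d, 0; 0, codeg G x z, 0, codeg G x z + f] := by
    have z1 : codeg G w x = 0 := codeg_eq_zero fun t h1 h2 => ht _ _ _ h1 h2.symm hwx.symm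
    have z2 : codeg G x y = 0 := codeg_eq_zero fun t h1 h2 => ht _ _ _ h1 h2.symm hxy.symm
    have z3 : codeg G y z = 0 := codeg_eq_zero fun t h1 h2 => ht _ _ _ h1 h2.symm hyz.symm
    have z4 : codeg G w z = 0 := codeg_eq_zero hwz'
    ext i j
    fin_cases i <;> fin_cases j <;>
      simp [z1, z2, z3, z4, codeg_comm x w, codeg_comm y x, codeg_comm z y, codeg_comm z w,
        he, hf, ha, hd, codeg_comm y w, codeg_comm z x]
  have hMG : M * !![(codeg G w y + e : ℝ), 0, codeg G w y, 0; 0, codeg G x z + a, 0, codeg G x z;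
        (codeg G w y : ℝ), 0, codeg G w y + d, 0; 0, codeg G x z, 0, codeg G x z + f] =
      !![0, (a : ℝ), 0, -f; codeg G w y + e, 0, codeg G w y, 0; 0, codeg G x z, 0,
        codeg G x z + f; -e, 0, d, 0] := by
    ext i j
    fin_cases i <;> fin_cases j <;> simp [M, Matrix.mul_apply, Fin.sum_univ_four]
  rw [hG, hMG] at hch
  generalize codeg G w y = b at *
  generalize codeg G x z = c at *
  have h0 := congrArg (Polynomial.eval 0) hch
  have h1 := congrArg (Polynomial.eval 1) hch
  rw [eval_charpoly_kernelMatrix, eval_charpoly_bipartite] at h0 h1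
  have he0 : (e : ℝ) * f = 0 := by
    rcases hef with h | h
    · simp [show e = 0 by omega]
    · simp [show f = 0 by omega]
  refine sizes_of_path_blowup (e := e) (f := f) ha1 hb1 hc1 hd1 ?_ ?_ ?_
  · exact_mod_cast mul_eq_zero.1 he0
  · rify
    linear_combination -h0
  · rify
    linear_combination h1 - h0 - he0

theorem false_of_induced_matching (hA : adjMat G = L * R) (hK : R * L = kernelMatrix q)
    (ht : ∀ u v t, G.Adj u v → G.Adj v t → ¬ G.Adj t u)
    (hP : ∀ w x y z, G.Adj w x → G.Adj x y → G.Adj y z → ¬ G.Adj w z →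
      G.Adj w y ∨ G.Adj x z) {w x y z : V}
    (hwx : G.Adj w x) (hyz : G.Adj y z) (hwy : ¬ G.Adj w y) (hwz : ¬ G.Adj w z)
    (hxy : ¬ G.Adj x y) (hxz : ¬ G.Adj x z) : False := by
  let M : Matrix (Fin 4) (Fin 4) ℝ := !![0, 1, 0, 0; 1, 0, 0, 0; 0, 0, 0, 1; 0, 0, 1, 0]
  have hM : (adjMat G).submatrix ![w, x, y, z] ![w, x, y, z] * M = 1 := by
    have : (adjMat G).submatrix ![w, x, y, z] ![w, x, y, z] = M := by
      ext i j
      fin_cases i <;> fin_cases j <;>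
        simp [M, adjMat_apply, hwx, hxy, hyz, hwy, hxz, hwz, hwx.symm, hyz.symm,
          G.adj_comm y w, G.adj_comm z x, G.adj_comm z w, G.adj_comm y x]
    rw [this]
    ext i j
    fin_cases i <;> fin_cases j <;> simp [M, Matrix.mul_apply, Fin.sum_univ_four]
  have hch := charpoly_kernelMatrix_eq hA hK ![w, x, y, z] hM
  have sy : ∀ a b, G.Adj a b → G.Adj b a := fun a b h => h.symm
  have z1 : codeg G w x = 0 := codeg_eq_zero fun t h1 h2 => ht _ _ _ h1 h2.symm hwx.symm
  have z2 : codeg G y z = 0 := codeg_eq_zero fun t h1 h2 => ht _ _ _ h1 h2.symm hyz.symm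
  have z3 : codeg G w y = 0 := codeg_eq_zero (by grind)
  have z4 : codeg G w z = 0 := codeg_eq_zero (by grind)
  have z5 : codeg G x y = 0 := codeg_eq_zero (by grind)
  have z6 : codeg G x z = 0 := codeg_eq_zero (by grind)
  have hG : (of fun i j => (codeg G (![w, x, y, z] i) (![w, x, y, z] j) : ℝ)) =
      diagonal ![(codeg G w w : ℝ), codeg G x x, codeg G y y, codeg G z z] := by
    ext i j
    fin_cases i <;> fin_cases j <;>
      simp [z1, z2, z3, z4, z5, z6, codeg_comm x w, codeg_comm y x, codeg_comm z y,
        codeg_comm z w, codeg_comm y w, codeg_comm z x]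
  have hMG : M * diagonal ![(codeg G w w : ℝ), codeg G x x, codeg G y y, codeg G z z] =
      !![0, (codeg G x x : ℝ), 0, 0; codeg G w w, 0, 0, 0; 0, 0, 0, codeg G z z;
        0, 0, codeg G y y, 0] := by
    ext i j
    fin_cases i <;> fin_cases j <;> simp [M]
  rw [hG, hMG] at hch
  have p1 := codeg_pos hwx hwx
  have p2 := codeg_pos hwx.symm hwx.symm
  have p3 := codeg_pos hyz hyz
  have p4 := codeg_pos hyz.symm hyz.symm
  generalize codeg G w w = a at *
  generalize codeg G x x = b at *
  generalize codeg G y y = c at *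
  generalize codeg G z z = d at *
  have h0 := congrArg (Polynomial.eval 0) hch
  have h1 := congrArg (Polynomial.eval 1) hch
  rw [eval_charpoly_kernelMatrix, eval_charpoly_bipartite] at h0 h1
  refine not_two_complete_bipartite_sizes (q := q) p1 p2 p3 p4 ?_ ?_
  · rify
    linear_combination -h0
  · rify
    linear_combination h1 - h0

theorem false_of_complete_bipartite (hq : q ≠ 0) (hA : adjMat G = L * R)
    (hK : R * L = kernelMatrix q) (ht : ∀ u v t, G.Adj u v → G.Adj v t → ¬ G.Adj t u) {w x : V}
    (hwx : G.Adj w x)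
    (h : ∀ u v, G.Adj u v ↔ (G.Adj u w ∧ G.Adj x v) ∨ (G.Adj u x ∧ G.Adj w v)) : False := by
  have hA' : adjMat G = (adjMat G).submatrix id ![w, x] * (adjMat G).submatrix ![x, w] id := by
    ext u v
    have h1 := h u v
    have h2 : ¬ (G.Adj u w ∧ G.Adj u x) := fun h2 => ht _ _ _ h2.1 hwx h2.2.symm
    have h3 : adjMat G u v = adjMat G u w * adjMat G x v + adjMat G u x * adjMat G w v := by
      simp only [adjMat_apply, h1]
      split_ifs <;> first | tauto | simp
    rw [Matrix.mul_apply, Fin.sum_univ_two]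
    exact h3
  have hc := Matrix.X_pow_mul_charpoly_eq (hA.symm.trans hA')
  rw [hK] at hc
  simp only [Fintype.card_fin] at hc
  rw [show (X : ℝ[X]) ^ 4 = X ^ 2 * X ^ 2 by ring, mul_assoc] at hc
  have := congrArg (Polynomial.eval 0) (mul_left_cancel₀ (pow_ne_zero 2 X_ne_zero) hc)
  rw [eval_charpoly_kernelMatrix] at this
  simp [hq] at this

omit [DecidableEq V] in
theorem nonempty_iso_of_induced_path (hcard : Fintype.card V = q + 3)
    (ht : ∀ u v t, G.Adj u v → G.Adj v t → ¬ G.Adj t u) {w x z : V}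
    (hwx : G.Adj w x) (hxz : ¬ G.Adj x z) (hwz : ¬ G.Adj w z) (hne : x ≠ z) (hne' : w ≠ z)
    (hc : codeg G x z = q) : Nonempty (KpqPlus 2 q ≃g G) := by
  classical
  let s := Finset.univ.filter fun t => G.Adj x t ∧ G.Adj z t
  have hs : Fintype.card s = q := by
    rw [Fintype.card_coe, ← hc, codeg]
  let e : Fin q ≃ s := (finCongr hs.symm).trans (Fintype.equivFin s).symm
  have he : ∀ j, G.Adj x (e j) ∧ G.Adj z (e j) := fun j => by
    simpa only [s, Finset.mem_filter, Finset.mem_univ, true_and] using (e j).2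
  have hinj : ∀ i j, (e i : V) = e j ↔ i = j := fun i j => by
    rw [← Subtype.ext_iff, e.injective.eq_iff]
  let φ : (Fin 2 ⊕ Fin q) ⊕ Unit → V :=
    Sum.elim (Sum.elim ![x, z] fun j => e j) fun _ => w
  have hew : ∀ j, ¬ G.Adj w (e j) := fun j h => ht _ _ _ h (he j).1.symm hwx.symm
  have hee : ∀ i j, ¬ G.Adj (e i) (e j) := fun i j h => ht _ _ _ h (he j).1.symm (he i).1
  have hφ : Function.Injective φ := by
    have hxw := hwx.ne'
    have hxe : ∀ j, x ≠ e j := fun j => (he j).1.ne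
    have hze : ∀ j, z ≠ e j := fun j => (he j).2.ne
    have hwe : ∀ j, w ≠ e j := fun j h => hwz (h ▸ (he j).2.symm)
    intro u v h
    rcases u with (i | i) | i <;> rcases v with (j | j) | j <;>
      (try fin_cases i) <;> (try fin_cases j) <;>
      simp [φ, hne, hne.symm, hne', hne'.symm, hxw, hxw.symm, hxe, hze, hwe, hinj,
        fun j => (hxe j).symm, fun j => (hze j).symm, fun j => (hwe j).symm] at h ⊢
    exact h
  have hbij : Function.Bijective φ :=
    (Fintype.bijective_iff_injective_and_card φ).2 ⟨hφ, by simp [hcard]; omega⟩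
  refine ⟨⟨Equiv.ofBijective φ hbij, ?_⟩⟩
  have sy : ∀ a b, G.Adj a b → G.Adj b a := fun a b h => h.symm
  intro u v
  rcases u with (i | i) | i <;> rcases v with (j | j) | j <;>
    (try fin_cases i) <;> (try fin_cases j) <;>
    simp [φ, KpqPlus, he, hew, hee, hwx, hwx.symm, hxz, hwz, fun j => (he j).1.symm,
      fun j => (he j).2.symm, fun j => G.adj_comm (e j) w, G.adj_comm z x, G.adj_comm z w]

end Classification

/-- For every integer `q ≥ 2`, the graph `K_{2,q}⁺` is determined by its
spectrum. -/
theorem K2qPlus_isDS (q : ℕ) (hq : 2 ≤ q) :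
    IsDS.{u} (KpqPlus 2 q) := by
  intro W _ _ H hcos
  obtain ⟨L₀, R₀, h₀, hK₀⟩ := exists_factorization_adjMat_KpqPlus q
  have hcard : Fintype.card W = q + 3 := by
    rw [← Matrix.card_eq_of_charpoly_eq hcos]
    simp
    omega
  obtain ⟨L, R, hA, hK⟩ := Matrix.exists_factorization_of_charpoly_eq (adjMat_isHermitian H)
    (h₀ ▸ adjMat_isHermitian (KpqPlus 2 q)) (h₀ ▸ hcos.symm)
  rw [hK₀] at hK
  have ht : ∀ u v t, H.Adj u v → H.Adj v t → ¬ H.Adj t u := fun u v t =>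
    triangleFree_of_trace_eq_zero (by
      rw [← trace_kernelMatrix_cube q, ← hK, hA, Matrix.mul_assoc L, Matrix.mul_assoc L,
        Matrix.trace_mul_comm]
      simp only [Matrix.mul_assoc])
  by_cases hP : ∀ w x y z, H.Adj w x → H.Adj x y → H.Adj y z → ¬ H.Adj w z →
      H.Adj w y ∨ H.Adj x z
  · exfalso
    by_cases hM : ∀ w x y z, H.Adj w x → H.Adj y z →
        H.Adj w y ∨ H.Adj w z ∨ H.Adj x y ∨ H.Adj x z
    · by_cases hE : ∃ w x, H.Adj w x
      · obtain ⟨w, x, hwx⟩ := hE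
        exact false_of_complete_bipartite (by omega) hA hK ht hwx
          (adj_iff_of_forall_not_path ht hP hM hwx)
      · push Not at hE
        have h0 : L * R = (0 : Matrix W (Fin 4) ℝ) * (0 : Matrix (Fin 4) W ℝ) := by
          rw [← hA]
          ext u v
          simp [adjMat_apply, hE]
        have := congrArg (Polynomial.eval 0) (Matrix.charpoly_eq_of_mul_eq_mul h0)
        rw [hK, eval_charpoly_kernelMatrix] at this
        simp at this
        omega
    · push Not at hM
      obtain ⟨w, x, y, z, hwx, hyz, hwy, hwz, hxy, hxz⟩ := hM
      exact false_of_induced_matching hA hK ht hP hwx hyz hwy hwz hxy hxz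
  · push Not at hP
    obtain ⟨w, x, y, z, hwx, hxy, hyz, hwz, hwy, hxz⟩ := hP
    rcases codeg_eq_of_induced_path hA hK ht hwx hxy hyz hwy hxz hwz with h | h
    · refine nonempty_iso_of_induced_path hcard ht hyz.symm (fun h => hwy h.symm)
        (fun h => hwz h.symm) ?_ ?_ ((codeg_comm _ _).trans h)
      · rintro rfl
        exact hwz hyz
      · rintro rfl
        exact hxz hwx.symm
    · refine nonempty_iso_of_induced_path hcard ht hwx hxz hwz ?_ ?_ h
      · rintro rfl
        exact hwz hwx
      · rintro rfl
        exact hwy hyz.symm
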